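/- arXiv:2311.14681 — 10 statements merged into one kernel-verified Lean document; each statement's English description precedes it below -/
import Mathlib

section
/- If f : X^n → ℝ is sample-monotone, then the image of f is a convex subset of ℝ: for any a, b in the image of f and any c with a ≤ c ≤ b, c is also in the image of f. -/
open scoped Classical

/-- Hamming distance between two datasets in `X^n`. -/
noncomputable def hdist {n : ℕ} {X : Type*} (x x' : Fin n → X) : ℕ :=
  (Finset.univ.filter fun i => x i ≠ x' i).card

/-- The inverse sensitivity `len_f(x;t)`, valued in `ℕ ∪ {∞}` with `inf ∅ = ∞`. -/
noncomputable def invSens {n : ℕ} {X T : Type*} (f : (Fin n → X) → T)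
    (x : Fin n → X) (t : T) : ℕ∞ :=
  sInf ((fun x' : Fin n → X => (hdist x x' : ℕ∞)) '' {x' | f x' = t})

/-- `f` is sample-monotone if for every `x` and `s, t` with `f x ≤ s ≤ t` or
`t ≤ s ≤ f x`, we have `len_f(x;s) ≤ len_f(x;t)`. -/
def SampleMonotone {n : ℕ} {X : Type*} (f : (Fin n → X) → ℝ) : Prop :=
  ∀ (x : Fin n → X) (s t : ℝ), ((f x ≤ s ∧ s ≤ t) ∨ (t ≤ s ∧ s ≤ f x)) →
    invSens f x s ≤ invSens f x t

/-- A value whose inverse sensitivity at some dataset is finite is attained. -/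
theorem mem_range_of_invSens_ne_top {n : ℕ} {X T : Type*} {f : (Fin n → X) → T}
    {x : Fin n → X} {t : T} (h : invSens f x t ≠ ⊤) : t ∈ Set.range f := by
  contrapose! h
  have hempty : {x' | f x' = t} = ∅ :=
    Set.eq_empty_of_forall_notMem fun x' hx' => h ⟨x', hx'⟩
  simp [invSens, hempty]

/-- The inverse sensitivity of an attained value is at most the distance to a preimage. -/
theorem invSens_apply_le_hdist {n : ℕ} {X T : Type*} (f : (Fin n → X) → T)
    (x x' : Fin n → X) : invSens f x (f x') ≤ hdist x x' :=
  sInf_le ⟨x', rfl, rfl⟩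

/-- If `f` is sample-monotone then the image of `f` is a convex subset of `ℝ`. -/
theorem stmt1 {n : ℕ} {X : Type*} (f : (Fin n → X) → ℝ) (hf : SampleMonotone f) :
    ∀ a ∈ Set.range f, ∀ b ∈ Set.range f, ∀ c : ℝ, a ≤ c → c ≤ b → c ∈ Set.range f := by
  rintro _ ⟨x, rfl⟩ _ ⟨y, rfl⟩ c hxc hcy
  exact mem_range_of_invSens_ne_top <| ne_top_of_le_ne_top (ENat.natCast_ne_top _) <|
    (hf x c (f y) (.inl ⟨hxc, hcy⟩)).trans (invSens_apply_le_hdist f x y)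
end

section
/- Let f : X^n → ℝ be bounded, and let Ū^ℓ_f and L̄^ℓ_f be approximate upper and lower sensitivity bounding functions for f. Then for any neighboring datasets x, x' ∈ X^n and any t ∈ ℝ with inf_{z ∈ X^n} f(z) ≤ t ≤ sup_{z ∈ X^n} f(z), the approximate inverse sensitivities satisfy len̄_f(x;t) ≤ n, len̄_f(x';t) ≤ n, and |len̄_f(x;t) − len̄_f(x';t)| ≤ 1. -/
open scoped Classical

/-- The exact upper output bound `U^ℓ_f(x)` (for bounded `f`). -/
noncomputable def upperBd {n : ℕ} {X : Type*} (f : (Fin n → X) → ℝ)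
    (x : Fin n → X) (ℓ : ℕ) : ℝ :=
  sSup (f '' {x' | hdist x x' ≤ ℓ})

/-- The exact lower output bound `L^ℓ_f(x)` (for bounded `f`). -/
noncomputable def lowerBd {n : ℕ} {X : Type*} (f : (Fin n → X) → ℝ)
    (x : Fin n → X) (ℓ : ℕ) : ℝ :=
  sInf (f '' {x' | hdist x x' ≤ ℓ})

/-- The approximate inverse sensitivity
`len̄_f(x;t) = inf{ ℓ ∈ ℕ : L̄^ℓ_f(x) ≤ t ≤ Ū^ℓ_f(x) }`, valued in `ℕ ∪ {∞}`. -/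
noncomputable def approxInvSens {n : ℕ} {X : Type*}
    (U L : ℕ → (Fin n → X) → ℝ) (x : Fin n → X) (t : ℝ) : ℕ∞ :=
  sInf ((fun ℓ : ℕ => (ℓ : ℕ∞)) '' {ℓ : ℕ | L ℓ x ≤ t ∧ t ≤ U ℓ x})

theorem hdist_comm {n : ℕ} {X : Type*} (x x' : Fin n → X) : hdist x x' = hdist x' x := by
  simp only [hdist, ne_comm]

theorem hdist_le {n : ℕ} {X : Type*} (x x' : Fin n → X) : hdist x x' ≤ n :=
  (Finset.card_le_univ _).trans_eq (Fintype.card_fin n)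

theorem upperBd_self {n : ℕ} {X : Type*} (f : (Fin n → X) → ℝ) (x : Fin n → X) :
    upperBd f x n = sSup (Set.range f) := by
  simp [upperBd, hdist_le]

theorem lowerBd_self {n : ℕ} {X : Type*} (f : (Fin n → X) → ℝ) (x : Fin n → X) :
    lowerBd f x n = sInf (Set.range f) := by
  simp [lowerBd, hdist_le]

theorem approxInvSens_le {n : ℕ} {X : Type*} {U L : ℕ → (Fin n → X) → ℝ} {x : Fin n → X}
    {t : ℝ} {ℓ : ℕ} (hL : L ℓ x ≤ t) (hU : t ≤ U ℓ x) : approxInvSens U L x t ≤ ℓ :=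
  sInf_le ⟨ℓ, ⟨hL, hU⟩, rfl⟩

theorem approxInvSens_le_add_one {n : ℕ} {X : Type*} {U L : ℕ → (Fin n → X) → ℝ}
    {x x' : Fin n → X} (hU : ∀ ℓ, U ℓ x' ≤ U (ℓ + 1) x) (hL : ∀ ℓ, L (ℓ + 1) x ≤ L ℓ x')
    (t : ℝ) : approxInvSens U L x t ≤ approxInvSens U L x' t + 1 := by
  rcases Set.eq_empty_or_nonempty {ℓ : ℕ | L ℓ x' ≤ t ∧ t ≤ U ℓ x'} with h | h
  · simp [approxInvSens, h]
  · obtain ⟨ℓ, ⟨hLt, htU⟩, hℓ⟩ := csInf_mem (h.image fun ℓ : ℕ => (ℓ : ℕ∞))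
    have hx' : approxInvSens U L x' t = ℓ := hℓ.symm
    rw [hx']
    exact_mod_cast approxInvSens_le ((hL ℓ).trans hLt) (htU.trans (hU ℓ))

/-- For bounded `f` and approximate upper and lower sensitivity bounding functions,
for neighboring `x, x'` and `inf f ≤ t ≤ sup f`, the approximate inverse
sensitivities are at most `n` and differ by at most `1`. -/
theorem stmt4 {n : ℕ} {X : Type*} (f : (Fin n → X) → ℝ)
    (hbdd : BddAbove (Set.range f) ∧ BddBelow (Set.range f))
    (U L : ℕ → (Fin n → X) → ℝ)
    (hU1 : ∀ (ℓ : ℕ) (x : Fin n → X), upperBd f x ℓ ≤ U ℓ x)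
    (hU2 : ∀ (ℓ : ℕ) (x x' : Fin n → X), hdist x x' ≤ 1 → U ℓ x ≤ U (ℓ + 1) x')
    (hL1 : ∀ (ℓ : ℕ) (x : Fin n → X), L ℓ x ≤ lowerBd f x ℓ)
    (hL2 : ∀ (ℓ : ℕ) (x x' : Fin n → X), hdist x x' ≤ 1 → L (ℓ + 1) x' ≤ L ℓ x)
    (x x' : Fin n → X) (hnb : hdist x x' ≤ 1) (t : ℝ)
    (htl : sInf (Set.range f) ≤ t) (htu : t ≤ sSup (Set.range f)) :
    approxInvSens U L x t ≤ n ∧ approxInvSens U L x' t ≤ n ∧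
      approxInvSens U L x t ≤ approxInvSens U L x' t + 1 ∧
      approxInvSens U L x' t ≤ approxInvSens U L x t + 1 := by
  have hle (z : Fin n → X) : approxInvSens U L z t ≤ n :=
    approxInvSens_le ((hL1 n z).trans ((lowerBd_self f z).trans_le htl))
      ((htu.trans_eq (upperBd_self f z).symm).trans (hU1 n z))
  have hnb' : hdist x' x ≤ 1 := hdist_comm x x' ▸ hnb
  exact ⟨hle x, hle x',
    approxInvSens_le_add_one (fun ℓ => hU2 ℓ x' x hnb') (fun ℓ => hL2 ℓ x' x hnb') t,
    approxInvSens_le_add_one (fun ℓ => hU2 ℓ x x' hnb) (fun ℓ => hL2 ℓ x x' hnb) t⟩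
end

section
/- For any x ∈ ℝ^n with n ≥ 1 and any proper subset S ⊊ {1,…,n}, the infimum over all x' ∈ ℝ^n agreeing with x on every coordinate outside S of Var(x') equals ((n − |S|)/n) · Var(x restricted to the complement of S), and this infimum is attained by setting every coordinate in S equal to the mean of the coordinates outside S. -/
open scoped Classical

/-- The mean of the coordinates of `x` indexed by `s`. -/
noncomputable def meanOn {n : ℕ} (s : Finset (Fin n)) (x : Fin n → ℝ) : ℝ :=
  (∑ i ∈ s, x i) / s.card

/-- The variance of the tuple of coordinates of `x` indexed by `s`. -/
noncomputable def varOn {n : ℕ} (s : Finset (Fin n)) (x : Fin n → ℝ) : ℝ :=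
  (∑ i ∈ s, (x i - meanOn s x) ^ 2) / s.card

/-- The variance of a dataset `x ∈ ℝ^n`. -/
noncomputable def Var {n : ℕ} (x : Fin n → ℝ) : ℝ :=
  varOn Finset.univ x

theorem card_mul_meanOn {n : ℕ} {s : Finset (Fin n)} (hs : s.Nonempty) (x : Fin n → ℝ) :
    (s.card : ℝ) * meanOn s x = ∑ i ∈ s, x i := by
  have : (s.card : ℝ) ≠ 0 := by exact_mod_cast hs.card_ne_zero
  rw [meanOn]
  field_simp

theorem card_mul_varOn {n : ℕ} {s : Finset (Fin n)} (hs : s.Nonempty) (x : Fin n → ℝ) :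
    (s.card : ℝ) * varOn s x = ∑ i ∈ s, (x i - meanOn s x) ^ 2 := by
  have : (s.card : ℝ) ≠ 0 := by exact_mod_cast hs.card_ne_zero
  rw [varOn]
  field_simp

/-- The mean minimizes the sum of squared deviations. -/
theorem card_mul_varOn_le_sum_sq_sub {n : ℕ} {s : Finset (Fin n)} (hs : s.Nonempty)
    (x : Fin n → ℝ) (c : ℝ) :
    (s.card : ℝ) * varOn s x ≤ ∑ i ∈ s, (x i - c) ^ 2 := by
  have expand (d : ℝ) : ∑ i ∈ s, (x i - d) ^ 2
      = ∑ i ∈ s, x i ^ 2 - 2 * d * ∑ i ∈ s, x i + s.card * d ^ 2 := by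
    simp only [sub_sq, Finset.sum_add_distrib, Finset.sum_sub_distrib, Finset.sum_const,
      nsmul_eq_mul, Finset.mul_sum]
    congr 2
    exact Finset.sum_congr rfl fun i _ => by ring
  rw [card_mul_varOn hs, expand, expand, ← card_mul_meanOn hs x]
  nlinarith [mul_nonneg (Nat.cast_nonneg (α := ℝ) s.card) (sq_nonneg (meanOn s x - c))]

theorem meanOn_compl_fill {n : ℕ} {S : Finset (Fin n)} (hS : Sᶜ.Nonempty) (x : Fin n → ℝ) :
    meanOn Finset.univ (fun i => if i ∈ S then meanOn Sᶜ x else x i) = meanOn Sᶜ x := by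
  have hu : (Finset.univ : Finset (Fin n)).Nonempty := hS.mono (Finset.subset_univ _)
  have hpos : ((Finset.univ : Finset (Fin n)).card : ℝ) ≠ 0 := by
    exact_mod_cast hu.card_ne_zero
  apply mul_left_cancel₀ hpos
  rw [card_mul_meanOn hu, ← Finset.sum_add_sum_compl S,
    Finset.sum_congr rfl (fun i hi => if_pos hi),
    Finset.sum_congr rfl (fun i hi => if_neg (Finset.mem_compl.mp hi)),
    ← card_mul_meanOn hS, Finset.sum_const, nsmul_eq_mul, ← add_mul, ← Nat.cast_add,
    Finset.card_add_card_compl, Finset.card_univ]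

/-- For any proper subset `S`, the infimum of `Var x'` over all `x'` agreeing with `x`
outside `S` equals `((n − |S|)/n) · Var(x restricted to Sᶜ)`, and it is attained by
setting every coordinate in `S` to the mean of the coordinates outside `S`. -/
theorem stmt6 {n : ℕ} (hn : 1 ≤ n) (x : Fin n → ℝ) (S : Finset (Fin n))
    (hS : S ⊂ Finset.univ) :
    sInf (Var '' {x' : Fin n → ℝ | ∀ i ∉ S, x' i = x i})
        = ((n : ℝ) - S.card) / n * varOn Sᶜ x ∧
      Var (fun i => if i ∈ S then meanOn Sᶜ x else x i)
        = ((n : ℝ) - S.card) / n * varOn Sᶜ x := by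
  have hc : Sᶜ.Nonempty := by
    rw [Finset.nonempty_iff_ne_empty, Ne, Finset.compl_eq_empty_iff]
    exact hS.ne
  have hcard : (Sᶜ.card : ℝ) = (n : ℝ) - S.card := by
    rw [eq_sub_iff_add_eq', ← Nat.cast_add, Finset.card_add_card_compl, Fintype.card_fin]
  have attained : Var (fun i => if i ∈ S then meanOn Sᶜ x else x i)
      = ((n : ℝ) - S.card) / n * varOn Sᶜ x := by
    rw [← hcard, div_mul_eq_mul_div, card_mul_varOn hc, Var, varOn, meanOn_compl_fill hc,
      Finset.card_univ, Fintype.card_fin, ← Finset.sum_add_sum_compl S,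
      Finset.sum_eq_zero (fun i hi => by simp [hi]), zero_add]
    congr 1
    exact Finset.sum_congr rfl fun i hi => by rw [if_neg (Finset.mem_compl.mp hi)]
  refine ⟨IsLeast.csInf_eq ⟨⟨_, fun i hi => if_neg hi, attained⟩, ?_⟩, attained⟩
  rintro _ ⟨y, hy, rfl⟩
  rw [← hcard, div_mul_eq_mul_div, Var, varOn.eq_1 Finset.univ, Finset.card_univ, Fintype.card_fin]
  gcongr
  calc (Sᶜ.card : ℝ) * varOn Sᶜ x
      ≤ ∑ i ∈ Sᶜ, (x i - meanOn Finset.univ y) ^ 2 := card_mul_varOn_le_sum_sq_sub hc x _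
    _ = ∑ i ∈ Sᶜ, (y i - meanOn Finset.univ y) ^ 2 :=
        Finset.sum_congr rfl fun i hi => by rw [hy i (Finset.mem_compl.mp hi)]
    _ ≤ ∑ i, (y i - meanOn Finset.univ y) ^ 2 :=
        Finset.sum_le_sum_of_subset_of_nonneg (Finset.subset_univ _) fun _ _ _ => sq_nonneg _
end

section
/- Let a ≤ b be reals and let x, x' ∈ [a,b]^n with n ≥ 1 be neighboring datasets (differing in at most one coordinate). Then Var(x) ≤ Var(x') + (b−a)²/n. -/
open scoped Classical

/-- The mean minimizes the sum of squared deviations. -/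
lemma sum_sub_meanOn_sq_le {n : ℕ} (s : Finset (Fin n)) (x : Fin n → ℝ) (c : ℝ) :
    ∑ i ∈ s, (x i - meanOn s x) ^ 2 ≤ ∑ i ∈ s, (x i - c) ^ 2 := by
  rcases s.eq_empty_or_nonempty with rfl | hs
  · simp
  have hcard : (s.card : ℝ) ≠ 0 := by exact_mod_cast hs.card_pos.ne'
  have hsum : ∑ i ∈ s, x i = s.card * meanOn s x := by
    unfold meanOn
    field_simp
  have hdiff : ∑ i ∈ s, (x i - c) ^ 2 - ∑ i ∈ s, (x i - meanOn s x) ^ 2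
      = s.card * (meanOn s x - c) ^ 2 := by
    have hterm : ∀ i ∈ s, (x i - c) ^ 2 - (x i - meanOn s x) ^ 2
        = 2 * (meanOn s x - c) * x i + (c ^ 2 - meanOn s x ^ 2) := fun i _ => by ring
    rw [← Finset.sum_sub_distrib, Finset.sum_congr rfl hterm, Finset.sum_add_distrib,
      ← Finset.mul_sum, hsum, Finset.sum_const, nsmul_eq_mul]
    ring
  have hnonneg : 0 ≤ (s.card : ℝ) * (meanOn s x - c) ^ 2 := by positivity
  linarith

/-- The mean of finitely many points of an interval lies in that interval. -/
lemma meanOn_mem_Icc {n : ℕ} {s : Finset (Fin n)} (hs : s.Nonempty) {a b : ℝ} {x : Fin n → ℝ}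
    (hx : ∀ i ∈ s, x i ∈ Set.Icc a b) : meanOn s x ∈ Set.Icc a b := by
  have hcard : (0 : ℝ) < s.card := by exact_mod_cast hs.card_pos
  unfold meanOn
  constructor
  · rw [le_div_iff₀ hcard, mul_comm, ← nsmul_eq_mul]
    exact Finset.card_nsmul_le_sum s x a fun i hi => (hx i hi).1
  · rw [div_le_iff₀ hcard, mul_comm, ← nsmul_eq_mul]
    exact Finset.sum_le_card_nsmul s x b fun i hi => (hx i hi).2

/-- For neighboring datasets in `[a,b]^n`, `Var(x) ≤ Var(x') + (b−a)²/n`. -/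
theorem stmt8 {n : ℕ} (hn : 1 ≤ n) (a b : ℝ) (hab : a ≤ b) (x x' : Fin n → ℝ)
    (hx : ∀ i, x i ∈ Set.Icc a b) (hx' : ∀ i, x' i ∈ Set.Icc a b)
    (hnb : hdist x x' ≤ 1) :
    Var x ≤ Var x' + (b - a) ^ 2 / n := by
  have hne : (Finset.univ : Finset (Fin n)).Nonempty := ⟨⟨0, hn⟩, Finset.mem_univ _⟩
  have hmean := meanOn_mem_Icc hne fun i _ => hx' i
  unfold Var varOn
  set c := meanOn Finset.univ x'
  have hterm : ∀ i, (x i - c) ^ 2 ≤ (x' i - c) ^ 2 + if x i ≠ x' i then (b - a) ^ 2 else 0 := by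
    intro i
    split_ifs with h
    · have hdev : (x i - c) ^ 2 ≤ (b - a) ^ 2 :=
        sq_le_sq' (by linarith [(hx i).1, hmean.2]) (by linarith [(hx i).2, hmean.1])
      linarith [sq_nonneg (x' i - c)]
    · rw [not_not.mp h, add_zero]
  have hchange : ∑ i, (if x i ≠ x' i then (b - a) ^ 2 else 0) ≤ (b - a) ^ 2 := by
    rw [← Finset.sum_filter, Finset.sum_const, nsmul_eq_mul]
    have hcard : (hdist x x' : ℝ) ≤ 1 := by exact_mod_cast hnb
    exact mul_le_of_le_one_left (sq_nonneg _) hcard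
  have hsum : ∑ i, (x i - c) ^ 2 ≤ ∑ i, (x' i - c) ^ 2 + (b - a) ^ 2 := by
    refine (Finset.sum_le_sum fun i _ => hterm i).trans ?_
    rw [Finset.sum_add_distrib]
    linarith
  rw [Finset.card_univ, Fintype.card_fin, ← add_div]
  gcongr
  exact (sum_sub_meanOn_sq_le _ x c).trans hsum
end

section
/- Let 𝓛 : X → ℝ be bounded below and let f : X^n → ℝ be the linearly separable function f(x) = Σ_{i=1}^n 𝓛(x_i). Let x ∈ X^n be indexed so that 𝓛(x_1) ≤ … ≤ 𝓛(x_n). Then for every 0 ≤ ℓ ≤ n, the lower output bound satisfies L^ℓ_f(x) = Σ_{i=1}^{n−ℓ} 𝓛(x_i) + ℓ · inf_{z ∈ X} 𝓛(z). -/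
open scoped Classical

/-- For a nonnegative monotone `g`, the first `k` values have the smallest sum among all
index sets with at least `k` elements. -/
theorem sum_filter_val_lt_le_sum {n k : ℕ} {g : Fin n → ℝ} (hg : Monotone g)
    (hg0 : ∀ i, 0 ≤ g i) {T : Finset (Fin n)} (hk : k ≤ T.card) :
    ∑ i ∈ Finset.univ.filter (fun i : Fin n => i.val < k), g i ≤ ∑ i ∈ T, g i := by
  set A := Finset.univ.filter fun i : Fin n => i.val < k with hA
  have hkn : k ≤ n := hk.trans (by simpa using T.card_le_univ)
  have hAcard : A.card = k := by
    rw [hA, Fin.card_filter_val_lt, min_eq_right hkn]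
  have hcard : (A \ T).card ≤ (T \ A).card := by
    rwa [Finset.card_sdiff_le_card_sdiff_iff, hAcard]
  rw [← Finset.sum_sdiff_le_sum_sdiff]
  rcases hkn.lt_or_eq with h | h
  · calc ∑ i ∈ A \ T, g i ≤ (A \ T).card • g ⟨k, h⟩ :=
          Finset.sum_le_card_nsmul _ _ _ fun i hi => hg <| by
            have : i.val < k := by simpa [hA] using (Finset.mem_sdiff.mp hi).1
            exact this.le
      _ ≤ (T \ A).card • g ⟨k, h⟩ := nsmul_le_nsmul_left (hg0 _) hcard
      _ ≤ ∑ i ∈ T \ A, g i :=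
          Finset.card_nsmul_le_sum _ _ _ fun i hi => hg <| by
            simpa [hA, Fin.le_def] using (Finset.mem_sdiff.mp hi).2
  · have hT : T = Finset.univ := by
      rw [← Finset.card_eq_iff_eq_univ, Fintype.card_fin]
      exact le_antisymm (by simpa using T.card_le_univ) (h ▸ hk)
    have hAu : A = Finset.univ := by
      rw [← Finset.card_eq_iff_eq_univ, Fintype.card_fin, hAcard, h]
    rw [hT, hAu]

/-- For a linearly separable function `f(x) = Σ_i 𝓛(x_i)` with `𝓛` bounded below
and `x` indexed so that `𝓛(x_1) ≤ … ≤ 𝓛(x_n)`, the lower output bound at Hamming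
distance `ℓ ≤ n` is `Σ_{i=1}^{n−ℓ} 𝓛(x_i) + ℓ · inf 𝓛` (the sum being over the
0-based indices `i < n − ℓ`). -/
theorem stmt12 {n : ℕ} {X : Type*} [Nonempty X] (𝓛 : X → ℝ)
    (hbd : BddBelow (Set.range 𝓛)) (x : Fin n → X)
    (hsort : Monotone fun i => 𝓛 (x i)) (ℓ : ℕ) (hℓ : ℓ ≤ n) :
    sInf ((fun x' : Fin n → X => ∑ i, 𝓛 (x' i)) '' {x' | hdist x x' ≤ ℓ})
      = (∑ i ∈ Finset.univ.filter fun i : Fin n => i.val < n - ℓ, 𝓛 (x i))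
        + ℓ * sInf (Set.range 𝓛) := by
  have hcard : (Finset.univ.filter fun i : Fin n => i.val < n - ℓ).card = n - ℓ := by
    rw [Fin.card_filter_val_lt, min_eq_right (Nat.sub_le n ℓ)]
  apply le_antisymm
  · rw [← sub_le_iff_le_add', ← iInf, Real.mul_iInf_of_nonneg (Nat.cast_nonneg ℓ)]
    refine le_ciInf fun z => sub_le_iff_le_add'.mpr (csInf_le ?_ ?_)
    · refine ⟨∑ _i : Fin n, sInf (Set.range 𝓛), ?_⟩
      rintro _ ⟨x', -, rfl⟩
      exact Finset.sum_le_sum fun i _ => csInf_le hbd ⟨x' i, rfl⟩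
    · have hcompl : (Finset.univ.filter fun i : Fin n => ¬ i.val < n - ℓ).card = ℓ := by
        have h := Finset.card_filter_add_card_filter_not
          (s := (Finset.univ : Finset (Fin n))) (fun i : Fin n => i.val < n - ℓ)
        rw [hcard, Finset.card_univ, Fintype.card_fin] at h
        omega
      refine ⟨fun i => if i.val < n - ℓ then x i else z, ?_, ?_⟩
      · refine le_trans (Finset.card_le_card fun i hi => ?_) hcompl.le
        rw [Finset.mem_filter] at hi ⊢
        exact ⟨hi.1, fun h => hi.2 (if_pos h).symm⟩
      · simp only [apply_ite 𝓛]
        rw [Finset.sum_ite, Finset.sum_const, hcompl, nsmul_eq_mul]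
  · refine le_csInf ⟨_, x, by simp [hdist], rfl⟩ ?_
    rintro _ ⟨x', hx', rfl⟩
    set m := sInf (Set.range 𝓛)
    have hm : ∀ z, 0 ≤ 𝓛 z - m := fun z => sub_nonneg.mpr (csInf_le hbd ⟨z, rfl⟩)
    have hT : n - ℓ ≤ (Finset.univ.filter fun i => ¬ x i ≠ x' i).card := by
      have h := Finset.card_filter_add_card_filter_not
        (s := (Finset.univ : Finset (Fin n))) (fun i => x i ≠ x' i)
      rw [Finset.card_univ, Fintype.card_fin] at h
      change (Finset.univ.filter fun i => x i ≠ x' i).card ≤ ℓ at hx'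
      omega
    have key : ∑ i ∈ Finset.univ.filter (fun i : Fin n => i.val < n - ℓ), (𝓛 (x i) - m)
        ≤ ∑ i, (𝓛 (x' i) - m) :=
      calc _ ≤ ∑ i ∈ Finset.univ.filter (fun i => ¬ x i ≠ x' i), (𝓛 (x i) - m) :=
            sum_filter_val_lt_le_sum (fun i j hij => sub_le_sub_right (hsort hij) m)
              (fun i => hm (x i)) hT
        _ = ∑ i ∈ Finset.univ.filter (fun i => ¬ x i ≠ x' i), (𝓛 (x' i) - m) :=
            Finset.sum_congr rfl fun i hi => by
              rw [not_not.mp (Finset.mem_filter.mp hi).2]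
        _ ≤ _ := Finset.sum_le_sum_of_subset_of_nonneg (Finset.filter_subset _ _)
            fun i _ _ => hm (x' i)
    simp only [Finset.sum_sub_distrib, Finset.sum_const, hcard, Finset.card_univ,
      Fintype.card_fin, nsmul_eq_mul, Nat.cast_sub hℓ] at key
    linarith
end

section
/- Let 𝓛 : X → ℝ be bounded above and let f : X^n → ℝ be the linearly separable function f(x) = Σ_{i=1}^n 𝓛(x_i). Let x ∈ X^n be indexed so that 𝓛(x_1) ≤ … ≤ 𝓛(x_n). Then for every 0 ≤ ℓ ≤ n, the upper output bound satisfies U^ℓ_f(x) = Σ_{i=ℓ+1}^{n} 𝓛(x_i) + ℓ · sup_{z ∈ X} 𝓛(z). -/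
open scoped Classical

/-- The number of indices of `Fin n` below `ℓ ≤ n` is `ℓ`. -/
theorem card_filter_val_lt_of_le {n ℓ : ℕ} (hℓ : ℓ ≤ n) :
    (Finset.univ.filter fun i : Fin n => i.val < ℓ).card = ℓ := by
  simp [Fin.card_filter_val_lt, hℓ]

/-- A nonnegative antitone function on `Fin n` has its largest sums over sets of at most `ℓ`
indices on the initial segment of length `ℓ`. -/
theorem Antitone.sum_le_sum_filter_val_lt {n ℓ : ℕ} {g : Fin n → ℝ} (hg : Antitone g)
    (hg0 : ∀ i, 0 ≤ g i) (hℓ : ℓ ≤ n) (T : Finset (Fin n)) (hT : T.card ≤ ℓ) :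
    ∑ i ∈ T, g i ≤ ∑ i ∈ Finset.univ.filter (fun i : Fin n => i.val < ℓ), g i := by
  rcases hℓ.eq_or_lt with rfl | hlt
  · exact Finset.sum_le_sum_of_subset_of_nonneg (fun i _ => by simp) fun i _ _ => hg0 i
  · set c := g ⟨ℓ, hlt⟩ with hc
    have key : ∑ i ∈ T, (g i - c) ≤
        ∑ i ∈ Finset.univ.filter (fun i : Fin n => i.val < ℓ), (g i - c) := by
      rw [← Finset.filter_univ_mem T, Finset.sum_filter, Finset.sum_filter]
      refine Finset.sum_le_sum fun i _ => ?_
      by_cases hi : i.val < ℓ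
      · have : c ≤ g i := hg (Fin.le_def.2 hi.le)
        split_ifs <;> linarith
      · have : g i ≤ c := hg (Fin.le_def.2 (not_lt.1 hi))
        split_ifs <;> linarith
    rw [Finset.sum_sub_distrib, Finset.sum_sub_distrib, Finset.sum_const, Finset.sum_const,
      card_filter_val_lt_of_le hℓ, nsmul_eq_mul, nsmul_eq_mul] at key
    have : (T.card : ℝ) * c ≤ ℓ * c :=
      mul_le_mul_of_nonneg_right (by exact_mod_cast hT) (hg0 _)
    linarith

/-- For a linearly separable function `f(x) = Σ_i 𝓛(x_i)` with `𝓛` bounded above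
and `x` indexed so that `𝓛(x_1) ≤ … ≤ 𝓛(x_n)`, the upper output bound at Hamming
distance `ℓ ≤ n` is `Σ_{i=ℓ+1}^{n} 𝓛(x_i) + ℓ · sup 𝓛` (the sum being over the
0-based indices `i ≥ ℓ`). -/
theorem stmt13 {n : ℕ} {X : Type*} [Nonempty X] (𝓛 : X → ℝ)
    (hbd : BddAbove (Set.range 𝓛)) (x : Fin n → X)
    (hsort : Monotone fun i => 𝓛 (x i)) (ℓ : ℕ) (hℓ : ℓ ≤ n) :
    sSup ((fun x' : Fin n → X => ∑ i, 𝓛 (x' i)) '' {x' | hdist x x' ≤ ℓ})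
      = (∑ i ∈ Finset.univ.filter fun i : Fin n => ℓ ≤ i.val, 𝓛 (x i))
        + ℓ * sSup (Set.range 𝓛) := by
  have hle : ∀ z, 𝓛 z ≤ sSup (Set.range 𝓛) := fun z => le_csSup hbd ⟨z, rfl⟩
  set M := sSup (Set.range 𝓛)
  have hsplit : ∀ y : Fin n → ℝ, ∑ i, y i =
      ∑ i ∈ Finset.univ.filter (fun i : Fin n => i.val < ℓ), y i +
        ∑ i ∈ Finset.univ.filter (fun i : Fin n => ℓ ≤ i.val), y i := fun y => by
    simp only [← not_lt, Finset.sum_filter_add_sum_filter_not]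
  have hub : ∀ x' : Fin n → X, hdist x x' ≤ ℓ → ∑ i, 𝓛 (x' i) ≤
      (∑ i ∈ Finset.univ.filter fun i : Fin n => ℓ ≤ i.val, 𝓛 (x i)) + ℓ * M := by
    intro x' hx'
    have hT := Antitone.sum_le_sum_filter_val_lt (g := fun i => M - 𝓛 (x i))
      (fun i j hij => sub_le_sub_left (hsort hij) M) (fun i => sub_nonneg.2 (hle _)) hℓ _ hx'
    have hchange : ∑ i, 𝓛 (x' i) ≤ ∑ i, 𝓛 (x i) +
        ∑ i ∈ Finset.univ.filter (fun i => x i ≠ x' i), (M - 𝓛 (x i)) := by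
      rw [Finset.sum_filter, ← Finset.sum_add_distrib]
      refine Finset.sum_le_sum fun i _ => ?_
      split_ifs with h
      · linarith [hle (x' i)]
      · rw [not_not.1 h, add_zero]
    rw [Finset.sum_sub_distrib _ _ (s := Finset.univ.filter fun i : Fin n => i.val < ℓ),
      Finset.sum_const, card_filter_val_lt_of_le hℓ, nsmul_eq_mul] at hT
    linarith [hsplit fun i => 𝓛 (x i)]
  have hbdd : BddAbove ((fun x' : Fin n → X => ∑ i, 𝓛 (x' i)) '' {x' | hdist x x' ≤ ℓ}) :=
    ⟨_, Set.forall_mem_image.2 hub⟩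
  refine le_antisymm (csSup_le ⟨_, x, by simp [hdist], rfl⟩ (Set.forall_mem_image.2 hub)) ?_
  have hlb : ∀ z, (∑ i ∈ Finset.univ.filter fun i : Fin n => ℓ ≤ i.val, 𝓛 (x i)) + ℓ * 𝓛 z ≤
      sSup ((fun x' : Fin n → X => ∑ i, 𝓛 (x' i)) '' {x' | hdist x x' ≤ ℓ}) := by
    intro z
    refine le_csSup hbdd ⟨fun i => if i.val < ℓ then z else x i, ?_, ?_⟩
    · refine (Finset.card_le_card fun i hi => ?_).trans (card_filter_val_lt_of_le hℓ).le
      by_contra h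
      simp_all
    · dsimp only
      rw [hsplit, add_comm]
      congr 1
      · refine Finset.sum_congr rfl fun i hi => ?_
        rw [if_neg (not_lt.2 (Finset.mem_filter.1 hi).2)]
      · rw [Finset.sum_congr rfl fun i hi => by rw [if_pos (Finset.mem_filter.1 hi).2],
          Finset.sum_const, card_filter_val_lt_of_le hℓ, nsmul_eq_mul]
  rcases Nat.eq_zero_or_pos ℓ with rfl | hpos
  · simpa using hlb (Classical.arbitrary X)
  · have hpos' : (0 : ℝ) < ℓ := by exact_mod_cast hpos
    rw [← le_sub_iff_add_le', ← le_div_iff₀' hpos']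
    refine csSup_le (Set.range_nonempty 𝓛) (Set.forall_mem_range.2 fun z => ?_)
    rw [le_div_iff₀' hpos', le_sub_iff_add_le']
    exact hlb z
end

section
/- Let 𝓛 : X → ℝ and a, b ∈ ℝ satisfy a ≤ 𝓛(z) ≤ b for all z ∈ X, and let f : X^n → ℝ be the linearly separable function f(x) = Σ_{i=1}^n 𝓛(x_i). For 0 ≤ ℓ ≤ n define L̄^ℓ_f(x) = min{ Σ_{i∈S} 𝓛(x_i) : S ⊆ {1,…,n}, |S| = n−ℓ } + ℓ·a and Ū^ℓ_f(x) = max{ Σ_{i∈S} 𝓛(x_i) : S ⊆ {1,…,n}, |S| = n−ℓ } + ℓ·b. Then for every 0 ≤ ℓ ≤ n and every x ∈ X^n, L̄^ℓ_f(x) ≤ L^ℓ_f(x) and Ū^ℓ_f(x) ≥ U^ℓ_f(x); and for every 0 ≤ ℓ < n and every x' neighboring x, L̄^ℓ_f(x) ≥ L̄^{ℓ+1}_f(x') and Ū^ℓ_f(x) ≤ Ū^{ℓ+1}_f(x'). -/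
open scoped Classical

/-- `L̄^ℓ_f(x) = min{ Σ_{i∈S} 𝓛(x_i) : |S| = n−ℓ } + ℓ·a` for the linearly
separable function with per-coordinate loss `𝓛`. -/
noncomputable def LbarLS {n : ℕ} {X : Type*} (𝓛 : X → ℝ) (a : ℝ) (ℓ : ℕ)
    (x : Fin n → X) : ℝ :=
  (Finset.univ.powersetCard (n - ℓ)).inf'
    (Finset.powersetCard_nonempty.mpr (by simp [Nat.sub_le]))
    (fun S => ∑ i ∈ S, 𝓛 (x i)) + ℓ * a

/-- `Ū^ℓ_f(x) = max{ Σ_{i∈S} 𝓛(x_i) : |S| = n−ℓ } + ℓ·b` for the linearly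
separable function with per-coordinate loss `𝓛`. -/
noncomputable def UbarLS {n : ℕ} {X : Type*} (𝓛 : X → ℝ) (b : ℝ) (ℓ : ℕ)
    (x : Fin n → X) : ℝ :=
  (Finset.univ.powersetCard (n - ℓ)).sup'
    (Finset.powersetCard_nonempty.mpr (by simp [Nat.sub_le]))
    (fun S => ∑ i ∈ S, 𝓛 (x i)) + ℓ * b

section SensitivityBounds

variable {n : ℕ} {X : Type*} {𝓛 : X → ℝ} {a : ℝ} {ℓ : ℕ} {x x' : Fin n → X}

theorem LbarLS_le_sum {S : Finset (Fin n)} (hS : S.card = n - ℓ) :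
    LbarLS 𝓛 a ℓ x ≤ ∑ i ∈ S, 𝓛 (x i) + ℓ * a := by
  unfold LbarLS
  gcongr
  exact Finset.inf'_le (fun S => ∑ i ∈ S, 𝓛 (x i))
    (Finset.mem_powersetCard.mpr ⟨Finset.subset_univ S, hS⟩)

theorem exists_LbarLS_eq_sum (𝓛 : X → ℝ) (a : ℝ) (ℓ : ℕ) (x : Fin n → X) :
    ∃ S : Finset (Fin n), S.card = n - ℓ ∧ LbarLS 𝓛 a ℓ x = ∑ i ∈ S, 𝓛 (x i) + ℓ * a := by
  obtain ⟨S, hS, h⟩ := Finset.exists_mem_eq_inf'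
    (s := (Finset.univ : Finset (Fin n)).powersetCard (n - ℓ))
    (Finset.powersetCard_nonempty.mpr (by simp)) (fun S => ∑ i ∈ S, 𝓛 (x i))
  exact ⟨S, (Finset.mem_powersetCard.mp hS).2, by rw [LbarLS, h]⟩

theorem UbarLS_eq_neg_LbarLS_neg (𝓛 : X → ℝ) (b : ℝ) (ℓ : ℕ) (x : Fin n → X) :
    UbarLS 𝓛 b ℓ x = -LbarLS (fun z => -𝓛 z) (-b) ℓ x := by
  obtain ⟨S, hS, h⟩ := exists_LbarLS_eq_sum (fun z => -𝓛 z) (-b) ℓ x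
  rw [Finset.sum_neg_distrib] at h
  refine le_antisymm ?_ ?_
  · rw [UbarLS, ← le_sub_iff_add_le]
    refine Finset.sup'_le _ _ fun T hT => ?_
    have := LbarLS_le_sum (𝓛 := fun z => -𝓛 z) (a := -b) (x := x)
      (Finset.mem_powersetCard.mp hT).2
    rw [Finset.sum_neg_distrib] at this
    linarith
  · have := Finset.le_sup' (fun S => ∑ i ∈ S, 𝓛 (x i))
      (Finset.mem_powersetCard.mpr ⟨Finset.subset_univ S, hS⟩)
    rw [UbarLS]
    linarith

theorem LbarLS_le_of_hdist_le (ha : ∀ z, a ≤ 𝓛 z) (hℓ : ℓ ≤ n) (h : hdist x x' ≤ ℓ) :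
    LbarLS 𝓛 a ℓ x ≤ ∑ i, 𝓛 (x' i) := by
  obtain ⟨D, hD, -, hcard⟩ := Finset.exists_subsuperset_card_eq
    (Finset.subset_univ (Finset.univ.filter fun i => x i ≠ x' i)) h (by simpa using hℓ)
  have hcompl : ∑ i ∈ Dᶜ, 𝓛 (x i) = ∑ i ∈ Dᶜ, 𝓛 (x' i) := by
    refine Finset.sum_congr rfl fun i hi => ?_
    by_contra hne
    exact Finset.mem_compl.mp hi
      (hD (Finset.mem_filter.mpr ⟨Finset.mem_univ i, fun he => hne (he ▸ rfl)⟩))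
  have hsum : (ℓ : ℝ) * a ≤ ∑ i ∈ D, 𝓛 (x' i) := by
    simpa [hcard] using Finset.card_nsmul_le_sum D (fun i => 𝓛 (x' i)) a fun i _ => ha _
  calc LbarLS 𝓛 a ℓ x ≤ ∑ i ∈ Dᶜ, 𝓛 (x i) + ℓ * a :=
        LbarLS_le_sum (by rw [Finset.card_compl, hcard, Fintype.card_fin])
    _ ≤ ∑ i ∈ Dᶜ, 𝓛 (x' i) + ∑ i ∈ D, 𝓛 (x' i) := by rw [hcompl]; gcongr
    _ = ∑ i, 𝓛 (x' i) := Finset.sum_compl_add_sum D _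

theorem LbarLS_succ_le_of_hdist_le_one (ha : ∀ z, a ≤ 𝓛 z) (hℓ : ℓ < n)
    (h : hdist x x' ≤ 1) : LbarLS 𝓛 a (ℓ + 1) x' ≤ LbarLS 𝓛 a ℓ x := by
  obtain ⟨S, hS, hx⟩ := exists_LbarLS_eq_sum 𝓛 a ℓ x
  obtain ⟨j, hj, heq⟩ : ∃ j ∈ S, ∀ i ∈ S.erase j, x' i = x i := by
    by_cases hdiff : ∃ j ∈ S, x j ≠ x' j
    · obtain ⟨j, hj, hne⟩ := hdiff
      refine ⟨j, hj, fun i hi => ?_⟩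
      by_contra hi'
      exact Finset.ne_of_mem_erase hi (Finset.card_le_one.mp h i
        (by simpa using Ne.symm hi') j (by simpa using hne))
    · push Not at hdiff
      obtain ⟨j, hj⟩ := Finset.card_pos.mp (by omega : 0 < S.card)
      exact ⟨j, hj, fun i hi => (hdiff i (Finset.mem_of_mem_erase hi)).symm⟩
  have hle := LbarLS_le_sum (𝓛 := 𝓛) (a := a) (ℓ := ℓ + 1) (x := x') (S := S.erase j)
    (by rw [Finset.card_erase_of_mem hj]; omega)
  rw [Finset.sum_congr rfl fun i hi => congrArg 𝓛 (heq i hi)] at hle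
  have hsplit := Finset.sum_erase_add S (fun i => 𝓛 (x i)) hj
  push_cast at hle
  linarith [ha (x j)]

end SensitivityBounds

/-- For `a ≤ 𝓛 ≤ b`, the functions `L̄^ℓ_f` and `Ū^ℓ_f` are valid approximate
lower and upper sensitivity bounding functions for `f(x) = Σ_i 𝓛(x_i)`. -/
theorem stmt14 {n : ℕ} {X : Type*} [Nonempty X] (𝓛 : X → ℝ) (a b : ℝ)
    (hLa : ∀ z, a ≤ 𝓛 z) (hLb : ∀ z, 𝓛 z ≤ b) :
    (∀ ℓ ≤ n, ∀ x : Fin n → X,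
        LbarLS 𝓛 a ℓ x
            ≤ sInf ((fun x' : Fin n → X => ∑ i, 𝓛 (x' i)) '' {x' | hdist x x' ≤ ℓ}) ∧
          sSup ((fun x' : Fin n → X => ∑ i, 𝓛 (x' i)) '' {x' | hdist x x' ≤ ℓ})
            ≤ UbarLS 𝓛 b ℓ x) ∧
      (∀ ℓ < n, ∀ x x' : Fin n → X, hdist x x' ≤ 1 →
        LbarLS 𝓛 a (ℓ + 1) x' ≤ LbarLS 𝓛 a ℓ x ∧
          UbarLS 𝓛 b ℓ x ≤ UbarLS 𝓛 b (ℓ + 1) x') := by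
  have hb (z : X) : -b ≤ -𝓛 z := neg_le_neg (hLb z)
  refine ⟨fun ℓ hℓ x => ?_, fun ℓ hℓ x x' h => ⟨LbarLS_succ_le_of_hdist_le_one hLa hℓ h, ?_⟩⟩
  · have hne : ((fun x' : Fin n → X => ∑ i, 𝓛 (x' i)) '' {x' | hdist x x' ≤ ℓ}).Nonempty :=
      ⟨_, x, by simp [hdist], rfl⟩
    refine ⟨le_csInf hne ?_, csSup_le hne ?_⟩
    · rintro _ ⟨x', h, rfl⟩
      exact LbarLS_le_of_hdist_le hLa hℓ h
    · rintro _ ⟨x', h, rfl⟩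
      have := LbarLS_le_of_hdist_le hb hℓ h
      rw [Finset.sum_neg_distrib] at this
      rw [UbarLS_eq_neg_LbarLS_neg]
      exact le_neg_of_le_neg this
  · rw [UbarLS_eq_neg_LbarLS_neg, UbarLS_eq_neg_LbarLS_neg]
    exact neg_le_neg (LbarLS_succ_le_of_hdist_le_one hb hℓ h)
end

section
/- Let 𝓛 : X → ℝ and a, b ∈ ℝ satisfy a ≤ 𝓛(z) ≤ b for all z ∈ X, let f(x) = Σ_{i=1}^n 𝓛(x_i), and for 0 ≤ ℓ ≤ n define L̄^ℓ_f(x) = min{ Σ_{i∈S} 𝓛(x_i) : S ⊆ {1,…,n}, |S| = n−ℓ } + ℓ·a and Ū^ℓ_f(x) = max{ Σ_{i∈S} 𝓛(x_i) : S ⊆ {1,…,n}, |S| = n−ℓ } + ℓ·b. Then for any neighboring datasets x, x' ∈ X^n with f(x) ≤ f(x'), we have L̄^ℓ_f(x) ≤ L̄^ℓ_f(x') and Ū^ℓ_f(x) ≤ Ū^ℓ_f(x') for every 0 ≤ ℓ ≤ n. -/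
open scoped Classical

/-- If two datasets differ in at most one coordinate, an inequality between the total losses
holds coordinatewise. -/
theorem loss_le_of_sum_le {n : ℕ} {X : Type*} (𝓛 : X → ℝ) (x x' : Fin n → X)
    (hnb : hdist x x' ≤ 1) (hff : ∑ i, 𝓛 (x i) ≤ ∑ i, 𝓛 (x' i)) (i : Fin n) :
    𝓛 (x i) ≤ 𝓛 (x' i) := by
  by_contra! hlt
  have hne : x i ≠ x' i := fun h => hlt.ne (by rw [h])
  have heq : ∀ j, j ≠ i → x j = x' j := fun j hj => by
    by_contra hjne
    exact hj (Finset.card_le_one.mp hnb j (by simpa using hjne) i (by simpa using hne))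
  refine hff.not_gt (Finset.sum_lt_sum (fun j _ => ?_) ⟨i, Finset.mem_univ i, hlt⟩)
  by_cases hj : j = i
  · exact hj ▸ hlt.le
  · rw [heq j hj]

/-- For `a ≤ 𝓛 ≤ b` and neighboring datasets with `f(x) ≤ f(x')` where
`f(x) = Σ_i 𝓛(x_i)`, we have `L̄^ℓ_f(x) ≤ L̄^ℓ_f(x')` and `Ū^ℓ_f(x) ≤ Ū^ℓ_f(x')`
for every `0 ≤ ℓ ≤ n`. -/
theorem stmt15 {n : ℕ} {X : Type*} [Nonempty X] (𝓛 : X → ℝ) (a b : ℝ)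
    (hLa : ∀ z, a ≤ 𝓛 z) (hLb : ∀ z, 𝓛 z ≤ b)
    (x x' : Fin n → X) (hnb : hdist x x' ≤ 1)
    (hff : ∑ i, 𝓛 (x i) ≤ ∑ i, 𝓛 (x' i)) :
    ∀ ℓ ≤ n, LbarLS 𝓛 a ℓ x ≤ LbarLS 𝓛 a ℓ x' ∧
      UbarLS 𝓛 b ℓ x ≤ UbarLS 𝓛 b ℓ x' := by
  have hle := loss_le_of_sum_le 𝓛 x x' hnb hff
  intro ℓ _
  constructor
  · exact add_le_add_left (Finset.inf'_mono_fun fun S _ => Finset.sum_le_sum fun i _ => hle i) _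
  · exact add_le_add_left (Finset.sup'_mono_fun fun S _ => Finset.sum_le_sum fun i _ => hle i) _
end

section
/- Let 𝓛 : X → ℝ and a, b ∈ ℝ satisfy a ≤ 𝓛(z) ≤ b for all z ∈ X, let f(x) = Σ_{i=1}^n 𝓛(x_i), and for 0 ≤ ℓ ≤ n define L̄^ℓ_f(x) = min{ Σ_{i∈S} 𝓛(x_i) : S ⊆ {1,…,n}, |S| = n−ℓ } + ℓ·a and Ū^ℓ_f(x) = max{ Σ_{i∈S} 𝓛(x_i) : S ⊆ {1,…,n}, |S| = n−ℓ } + ℓ·b. Then for any neighboring datasets x, x' ∈ X^n with f(x) ≤ f(x') and every t ∈ ℝ with n·a ≤ t ≤ n·b, the approximate reflective inverse sensitivities satisfy Ψ̄_f(x;t) ≥ Ψ̄_f(x';t). -/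
open scoped Classical

/-- The approximate inverse sensitivity
`len̄_f(x;t) = inf{ ℓ ∈ ℕ : L̄^ℓ_f(x) ≤ t ≤ Ū^ℓ_f(x) }` (a natural number; the
defining set is nonempty whenever `n·a ≤ t ≤ n·b`). -/
noncomputable def alenLS {n : ℕ} {X : Type*} (𝓛 : X → ℝ) (a b : ℝ)
    (x : Fin n → X) (t : ℝ) : ℕ :=
  sInf {ℓ : ℕ | LbarLS 𝓛 a ℓ x ≤ t ∧ t ≤ UbarLS 𝓛 b ℓ x}

/-- The approximate reflective inverse sensitivity
`Ψ̄_f(x;t) = sgn(t − f(x))·(len̄_f(x;t) − 1/2)`, where `sgn 0 = 0` and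
`f(x) = Σ_i 𝓛(x_i)`. -/
noncomputable def aReflLS {n : ℕ} {X : Type*} (𝓛 : X → ℝ) (a b : ℝ)
    (x : Fin n → X) (t : ℝ) : ℝ :=
  Real.sign (t - ∑ i, 𝓛 (x i)) * ((alenLS 𝓛 a b x t : ℝ) - 1 / 2)

theorem loss_le_of_hdist_le_one {n : ℕ} {X : Type*} (𝓛 : X → ℝ) (x x' : Fin n → X)
    (hnb : hdist x x' ≤ 1) (hff : ∑ i, 𝓛 (x i) ≤ ∑ i, 𝓛 (x' i)) (j : Fin n) :
    𝓛 (x j) ≤ 𝓛 (x' j) := by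
  by_cases hj : x j = x' j
  · rw [hj]
  have hrest : ∑ i ∈ Finset.univ.erase j, 𝓛 (x i) = ∑ i ∈ Finset.univ.erase j, 𝓛 (x' i) := by
    refine Finset.sum_congr rfl fun i hi => ?_
    have hxi : x i = x' i := by
      by_contra hne
      exact Finset.ne_of_mem_erase hi
        (Finset.card_le_one.mp hnb i (by simpa using hne) j (by simpa using hj))
    rw [hxi]
  rw [← Finset.add_sum_erase _ (fun i => 𝓛 (x i)) (Finset.mem_univ j),
    ← Finset.add_sum_erase _ (fun i => 𝓛 (x' i)) (Finset.mem_univ j), hrest] at hff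
  linarith

section Bounds

variable {n : ℕ} {X : Type*} {𝓛 : X → ℝ} {a b : ℝ}

theorem card_compl_of_mem_powersetCard_sub {ℓ : ℕ} (hℓ : ℓ ≤ n) {S : Finset (Fin n)}
    (hS : S ∈ Finset.univ.powersetCard (n - ℓ)) : Sᶜ.card = ℓ := by
  rw [Finset.card_compl, (Finset.mem_powersetCard.mp hS).2, Fintype.card_fin]
  omega

theorem LbarLS_le_sum_s16 (hLa : ∀ z, a ≤ 𝓛 z) {ℓ : ℕ} (hℓ : ℓ ≤ n) (x : Fin n → X) :
    LbarLS 𝓛 a ℓ x ≤ ∑ i, 𝓛 (x i) := by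
  obtain ⟨S, hS⟩ : (Finset.univ.powersetCard (n - ℓ) : Finset (Finset (Fin n))).Nonempty :=
    Finset.powersetCard_nonempty.mpr (by simp)
  have hmin := Finset.inf'_le (fun S => ∑ i ∈ S, 𝓛 (x i)) hS
  have hcompl := Finset.card_nsmul_le_sum Sᶜ (fun i => 𝓛 (x i)) a fun i _ => hLa (x i)
  rw [card_compl_of_mem_powersetCard_sub hℓ hS, nsmul_eq_mul] at hcompl
  rw [← Finset.sum_add_sum_compl S]
  exact add_le_add hmin hcompl

theorem sum_le_UbarLS (hLb : ∀ z, 𝓛 z ≤ b) {ℓ : ℕ} (hℓ : ℓ ≤ n) (x : Fin n → X) :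
    ∑ i, 𝓛 (x i) ≤ UbarLS 𝓛 b ℓ x := by
  obtain ⟨S, hS⟩ : (Finset.univ.powersetCard (n - ℓ) : Finset (Finset (Fin n))).Nonempty :=
    Finset.powersetCard_nonempty.mpr (by simp)
  have hmax := Finset.le_sup' (fun S => ∑ i ∈ S, 𝓛 (x i)) hS
  have hcompl := Finset.sum_le_card_nsmul Sᶜ (fun i => 𝓛 (x i)) b fun i _ => hLb (x i)
  rw [card_compl_of_mem_powersetCard_sub hℓ hS, nsmul_eq_mul] at hcompl
  rw [← Finset.sum_add_sum_compl S]
  exact add_le_add hmax hcompl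

theorem LbarLS_mono {x x' : Fin n → X} (h : ∀ i, 𝓛 (x i) ≤ 𝓛 (x' i)) (ℓ : ℕ) :
    LbarLS 𝓛 a ℓ x ≤ LbarLS 𝓛 a ℓ x' :=
  add_le_add_left (Finset.inf'_mono_fun fun _ _ => Finset.sum_le_sum fun i _ => h i) _

theorem UbarLS_mono {x x' : Fin n → X} (h : ∀ i, 𝓛 (x i) ≤ 𝓛 (x' i)) (ℓ : ℕ) :
    UbarLS 𝓛 b ℓ x ≤ UbarLS 𝓛 b ℓ x' :=
  add_le_add_left (Finset.sup'_mono_fun fun _ _ => Finset.sum_le_sum fun i _ => h i) _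

theorem LbarLS_self (x : Fin n → X) : LbarLS 𝓛 a n x = n * a := by
  simp [LbarLS]

theorem UbarLS_self (x : Fin n → X) : UbarLS 𝓛 b n x = n * b := by
  simp [UbarLS]

theorem LbarLS_zero (x : Fin n → X) : LbarLS 𝓛 a 0 x = ∑ i, 𝓛 (x i) := by
  have h : (Finset.univ.powersetCard (n - 0) : Finset (Finset (Fin n))) = {Finset.univ} := by
    simpa using Finset.powersetCard_self (Finset.univ : Finset (Fin n))
  simp only [LbarLS, h, Finset.inf'_singleton, Nat.cast_zero, zero_mul, add_zero]

theorem UbarLS_zero (x : Fin n → X) : UbarLS 𝓛 b 0 x = ∑ i, 𝓛 (x i) := by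
  have h : (Finset.univ.powersetCard (n - 0) : Finset (Finset (Fin n))) = {Finset.univ} := by
    simpa using Finset.powersetCard_self (Finset.univ : Finset (Fin n))
  simp only [UbarLS, h, Finset.sup'_singleton, Nat.cast_zero, zero_mul, add_zero]

variable {t : ℝ}

theorem mem_alenLS_set_self (htl : n * a ≤ t) (htu : t ≤ n * b) (x : Fin n → X) :
    n ∈ {ℓ : ℕ | LbarLS 𝓛 a ℓ x ≤ t ∧ t ≤ UbarLS 𝓛 b ℓ x} :=
  ⟨(LbarLS_self x).trans_le htl, htu.trans_eq (UbarLS_self x).symm⟩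

theorem alenLS_le (htl : n * a ≤ t) (htu : t ≤ n * b) (x : Fin n → X) :
    alenLS 𝓛 a b x t ≤ n :=
  Nat.sInf_le (mem_alenLS_set_self htl htu x)

theorem alenLS_spec (htl : n * a ≤ t) (htu : t ≤ n * b) (x : Fin n → X) :
    LbarLS 𝓛 a (alenLS 𝓛 a b x t) x ≤ t ∧ t ≤ UbarLS 𝓛 b (alenLS 𝓛 a b x t) x :=
  Nat.sInf_mem ⟨n, mem_alenLS_set_self htl htu x⟩

theorem one_le_alenLS (htl : n * a ≤ t) (htu : t ≤ n * b) {x : Fin n → X}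
    (hne : t ≠ ∑ i, 𝓛 (x i)) : 1 ≤ alenLS 𝓛 a b x t := by
  refine Nat.one_le_iff_ne_zero.mpr fun h0 => hne ?_
  have h := alenLS_spec (𝓛 := 𝓛) htl htu x
  rw [h0, LbarLS_zero, UbarLS_zero] at h
  exact le_antisymm h.2 h.1

theorem alenLS_le_of_sum_le (hLa : ∀ z, a ≤ 𝓛 z) (htl : n * a ≤ t) (htu : t ≤ n * b)
    {x x' : Fin n → X} (h : ∀ i, 𝓛 (x i) ≤ 𝓛 (x' i)) (ht : ∑ i, 𝓛 (x' i) ≤ t) :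
    alenLS 𝓛 a b x' t ≤ alenLS 𝓛 a b x t :=
  Nat.sInf_le ⟨(LbarLS_le_sum_s16 hLa (alenLS_le htl htu x) x').trans ht,
    (alenLS_spec htl htu x).2.trans (UbarLS_mono h _)⟩

theorem alenLS_le_of_le_sum (hLb : ∀ z, 𝓛 z ≤ b) (htl : n * a ≤ t) (htu : t ≤ n * b)
    {x x' : Fin n → X} (h : ∀ i, 𝓛 (x i) ≤ 𝓛 (x' i)) (ht : t ≤ ∑ i, 𝓛 (x i)) :
    alenLS 𝓛 a b x t ≤ alenLS 𝓛 a b x' t :=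
  Nat.sInf_le ⟨(LbarLS_mono h _).trans (alenLS_spec htl htu x').1,
    ht.trans (sum_le_UbarLS hLb (alenLS_le htl htu x') x)⟩

theorem aReflLS_of_lt {x : Fin n → X} (ht : ∑ i, 𝓛 (x i) < t) :
    aReflLS 𝓛 a b x t = (alenLS 𝓛 a b x t : ℝ) - 1 / 2 := by
  rw [aReflLS, Real.sign_of_pos (sub_pos.mpr ht), one_mul]

theorem aReflLS_of_gt {x : Fin n → X} (ht : t < ∑ i, 𝓛 (x i)) :
    aReflLS 𝓛 a b x t = -((alenLS 𝓛 a b x t : ℝ) - 1 / 2) := by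
  rw [aReflLS, Real.sign_of_neg (sub_neg.mpr ht), neg_one_mul]

theorem aReflLS_nonneg (htl : n * a ≤ t) (htu : t ≤ n * b) {x : Fin n → X}
    (ht : ∑ i, 𝓛 (x i) ≤ t) : 0 ≤ aReflLS 𝓛 a b x t := by
  rcases ht.eq_or_lt with heq | hlt
  · simp [aReflLS, heq]
  · rw [aReflLS_of_lt hlt]
    have : (1 : ℝ) ≤ alenLS 𝓛 a b x t := by exact_mod_cast one_le_alenLS htl htu hlt.ne'
    linarith

theorem aReflLS_nonpos (htl : n * a ≤ t) (htu : t ≤ n * b) {x : Fin n → X}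
    (ht : t ≤ ∑ i, 𝓛 (x i)) : aReflLS 𝓛 a b x t ≤ 0 := by
  rcases ht.eq_or_lt with heq | hlt
  · simp [aReflLS, heq]
  · rw [aReflLS_of_gt hlt]
    have : (1 : ℝ) ≤ alenLS 𝓛 a b x t := by exact_mod_cast one_le_alenLS htl htu hlt.ne
    linarith

end Bounds

/-- For `a ≤ 𝓛 ≤ b`, neighboring datasets with `f(x) ≤ f(x')`, and any
`t ∈ [n·a, n·b]`, the approximate reflective inverse sensitivities satisfy
`Ψ̄_f(x;t) ≥ Ψ̄_f(x';t)`. -/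
theorem stmt16 {n : ℕ} {X : Type*} [Nonempty X] (𝓛 : X → ℝ) (a b : ℝ)
    (hLa : ∀ z, a ≤ 𝓛 z) (hLb : ∀ z, 𝓛 z ≤ b)
    (x x' : Fin n → X) (hnb : hdist x x' ≤ 1)
    (hff : ∑ i, 𝓛 (x i) ≤ ∑ i, 𝓛 (x' i))
    (t : ℝ) (htl : n * a ≤ t) (htu : t ≤ n * b) :
    aReflLS 𝓛 a b x' t ≤ aReflLS 𝓛 a b x t := by
  have hle := loss_le_of_hdist_le_one 𝓛 x x' hnb hff
  rcases lt_or_ge t (∑ i, 𝓛 (x i)) with h | h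
  · rw [aReflLS_of_gt h, aReflLS_of_gt (h.trans_le hff)]
    have : (alenLS 𝓛 a b x t : ℝ) ≤ alenLS 𝓛 a b x' t := by
      exact_mod_cast alenLS_le_of_le_sum hLb htl htu hle h.le
    linarith
  rcases lt_or_ge (∑ i, 𝓛 (x' i)) t with h' | h'
  · rw [aReflLS_of_lt h', aReflLS_of_lt (hff.trans_lt h')]
    have : (alenLS 𝓛 a b x' t : ℝ) ≤ alenLS 𝓛 a b x t := by
      exact_mod_cast alenLS_le_of_sum_le hLa htl htu hle h'.le
    linarith
  exact (aReflLS_nonpos htl htu h').trans (aReflLS_nonneg htl htu h)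
end

section
/- Let c ≥ 1, let ω : X → ℝ^c be a model with a ≤ ω(z)_j ≤ b for all z ∈ X and all j, and for a dataset (x,y) ∈ (X × {1,…,c})^n define the cross-entropy loss CE_ω(x,y) = −Σ_{i=1}^n log( exp(ω(x_i)_{y_i}) / Σ_{j=1}^c exp(ω(x_i)_j) ). Write 𝓛(x_i,y_i) = −log( exp(ω(x_i)_{y_i}) / Σ_{j=1}^c exp(ω(x_i)_j) ) for the per-example loss, B = −log( e^{a−b} / (e^{a−b} + c − 1) ), and for 0 ≤ ℓ ≤ n define Ū^ℓ(x,y) = ℓ·B + max{ Σ_{i∈S} 𝓛(x_i,y_i) : S ⊆ {1,…,n}, |S| = n−ℓ }. Then for every 0 ≤ ℓ ≤ n, Ū^ℓ(x,y) ≥ sup{ CE_ω(x',y') : d_ham((x,y),(x',y')) ≤ ℓ }, and for every 0 ≤ ℓ < n and every neighboring dataset (x',y'), Ū^ℓ(x,y) ≤ Ū^{ℓ+1}(x',y'). -/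
open scoped Classical

/-- The per-example softmax cross-entropy loss of model `ω` on example `(x_i, y_i)`. -/
noncomputable def ceLoss {X : Type*} {c : ℕ} (ω : X → Fin c → ℝ)
    (p : X × Fin c) : ℝ :=
  -Real.log (Real.exp (ω p.1 p.2) / ∑ j, Real.exp (ω p.1 j))

/-- The cross-entropy loss of model `ω` on a dataset of `n` labeled examples. -/
noncomputable def CE {X : Type*} {c n : ℕ} (ω : X → Fin c → ℝ)
    (d : Fin n → X × Fin c) : ℝ :=
  ∑ i, ceLoss ω (d i)

/-- The approximate upper bounding function
`Ū^ℓ(x,y) = ℓ·B + max{ Σ_{i∈S} 𝓛(x_i,y_i) : |S| = n−ℓ }` with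
`B = −log(e^{a−b}/(e^{a−b}+c−1))`. -/
noncomputable def UbarCE {X : Type*} {c n : ℕ} (ω : X → Fin c → ℝ) (a b : ℝ)
    (ℓ : ℕ) (d : Fin n → X × Fin c) : ℝ :=
  ℓ * (-Real.log (Real.exp (a - b) / (Real.exp (a - b) + c - 1))) +
    (Finset.univ.powersetCard (n - ℓ)).sup'
      (Finset.powersetCard_nonempty.mpr (by simp [Nat.sub_le]))
      (fun S => ∑ i ∈ S, ceLoss ω (d i))

/-- The per-example loss of a model with outputs in `[a, b]` is at most its worst-case value. -/
theorem ceLoss_le {X : Type*} {c : ℕ} (ω : X → Fin c → ℝ) (a b : ℝ)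
    (hω : ∀ z j, a ≤ ω z j ∧ ω z j ≤ b) (p : X × Fin c) :
    ceLoss ω p ≤ -Real.log (Real.exp (a - b) / (Real.exp (a - b) + c - 1)) := by
  obtain ⟨z, y⟩ := p
  have hc : (1 : ℝ) ≤ c := by exact_mod_cast y.pos
  have hsum : ∑ j, Real.exp (ω z j) ≤ Real.exp (ω z y) + (c - 1) * Real.exp b := by
    rw [← Finset.add_sum_erase _ _ (Finset.mem_univ y)]
    gcongr
    calc ∑ j ∈ Finset.univ.erase y, Real.exp (ω z j)
        ≤ ∑ _j ∈ Finset.univ.erase y, Real.exp b :=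
          Finset.sum_le_sum fun j _ => Real.exp_le_exp.2 (hω z j).2
      _ = (c - 1) * Real.exp b := by
          rw [Finset.sum_const, Finset.card_erase_of_mem (Finset.mem_univ y), Finset.card_fin,
            nsmul_eq_mul, Nat.cast_sub y.pos, Nat.cast_one]
  have hpos : 0 < ∑ j, Real.exp (ω z j) :=
    Finset.sum_pos (fun j _ => Real.exp_pos _) ⟨y, Finset.mem_univ y⟩
  have hexp : Real.exp (a - b) * Real.exp b = Real.exp a := by
    rw [← Real.exp_add, sub_add_cancel]
  have hea : Real.exp a ≤ Real.exp (ω z y) := Real.exp_le_exp.2 (hω z y).1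
  have hden : 0 < Real.exp (a - b) + c - 1 := by
    linarith [Real.exp_pos (a - b)]
  refine neg_le_neg (Real.log_le_log (div_pos (Real.exp_pos _) hden) ?_)
  rw [div_le_div_iff₀ hden hpos]
  calc Real.exp (a - b) * ∑ j, Real.exp (ω z j)
      ≤ Real.exp (a - b) * (Real.exp (ω z y) + (c - 1) * Real.exp b) := by gcongr
    _ = Real.exp (a - b) * Real.exp (ω z y) + (c - 1) * Real.exp a := by
        rw [← hexp]; ring
    _ ≤ Real.exp (a - b) * Real.exp (ω z y) + (c - 1) * Real.exp (ω z y) := by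
        gcongr
    _ = Real.exp (ω z y) * (Real.exp (a - b) + c - 1) := by ring

/-- Every sum over `n - ℓ` examples is dominated by the maximum defining `UbarCE`. -/
theorem add_sum_le_UbarCE {X : Type*} {c n : ℕ} (ω : X → Fin c → ℝ) (a b : ℝ) (ℓ : ℕ)
    (d : Fin n → X × Fin c) (S : Finset (Fin n)) (hS : S.card = n - ℓ) :
    ℓ * (-Real.log (Real.exp (a - b) / (Real.exp (a - b) + c - 1))) + ∑ i ∈ S, ceLoss ω (d i)
      ≤ UbarCE ω a b ℓ d :=
  add_le_add le_rfl (Finset.le_sup' (fun S => ∑ i ∈ S, ceLoss ω (d i))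
    (Finset.mem_powersetCard.2 ⟨Finset.subset_univ S, hS⟩))

theorem CE_le_UbarCE {X : Type*} {c n : ℕ} (ω : X → Fin c → ℝ) (a b : ℝ)
    (hω : ∀ z j, a ≤ ω z j ∧ ω z j ≤ b) {ℓ : ℕ} (hℓ : ℓ ≤ n) (d d' : Fin n → X × Fin c)
    (hd : hdist d d' ≤ ℓ) : CE ω d' ≤ UbarCE ω a b ℓ d := by
  obtain ⟨T, hDT, hT⟩ := Finset.exists_superset_card_eq hd (by simpa using hℓ)
  refine le_trans ?_ (add_sum_le_UbarCE ω a b ℓ d Tᶜ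
    (by rw [Finset.card_compl, hT, Fintype.card_fin]))
  rw [CE, ← Finset.sum_add_sum_compl T]
  refine add_le_add ?_ (Finset.sum_le_sum fun i hi => ?_)
  · rw [← hT, ← nsmul_eq_mul]
    exact Finset.sum_le_card_nsmul _ _ _ fun i _ => ceLoss_le ω a b hω (d' i)
  · have h : d i = d' i := by
      by_contra hne
      exact Finset.mem_compl.1 hi (hDT (by simpa using hne))
    rw [h]

theorem UbarCE_le_UbarCE_succ {X : Type*} {c n : ℕ} (ω : X → Fin c → ℝ) (a b : ℝ)
    (hω : ∀ z j, a ≤ ω z j ∧ ω z j ≤ b) {ℓ : ℕ} (hℓ : ℓ < n) (d d' : Fin n → X × Fin c)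
    (hd : hdist d d' ≤ 1) : UbarCE ω a b ℓ d ≤ UbarCE ω a b (ℓ + 1) d' := by
  rw [UbarCE, ← le_sub_iff_add_le']
  refine Finset.sup'_le _ _ fun S hS => ?_
  rw [le_sub_iff_add_le']
  have hcard := (Finset.mem_powersetCard.1 hS).2
  obtain ⟨i, hi, hagree⟩ : ∃ i ∈ S, ∀ j ∈ S.erase i, d j = d' j := by
    by_cases h : ∃ i ∈ S, d i ≠ d' i
    · obtain ⟨i, hi, hne⟩ := h
      refine ⟨i, hi, fun j hj => ?_⟩
      by_contra hj'
      exact Finset.ne_of_mem_erase hj (Finset.card_le_one.1 hd j (by simpa using hj') i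
        (by simpa using hne))
    · push Not at h
      obtain ⟨i, hi⟩ : S.Nonempty := Finset.card_pos.1 (by omega)
      exact ⟨i, hi, fun j hj => h j (Finset.mem_of_mem_erase hj)⟩
  refine le_trans ?_ (add_sum_le_UbarCE ω a b (ℓ + 1) d' (S.erase i)
    (by rw [Finset.card_erase_of_mem hi]; omega))
  rw [← Finset.add_sum_erase _ _ hi,
    Finset.sum_congr rfl fun j hj => congrArg (ceLoss ω) (hagree j hj)]
  push_cast
  linarith [ceLoss_le ω a b hω (d i)]

/-- For a model with outputs in `[a,b]^c`, the functions `Ū^ℓ` are valid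
approximate upper sensitivity bounding functions for the cross-entropy loss. -/
theorem stmt18 {X : Type*} {c n : ℕ} (hc : 1 ≤ c) (ω : X → Fin c → ℝ)
    (a b : ℝ) (hω : ∀ z j, a ≤ ω z j ∧ ω z j ≤ b) :
    (∀ ℓ ≤ n, ∀ d : Fin n → X × Fin c,
        sSup (CE ω '' {d' : Fin n → X × Fin c | hdist d d' ≤ ℓ}) ≤ UbarCE ω a b ℓ d) ∧
      (∀ ℓ < n, ∀ d d' : Fin n → X × Fin c, hdist d d' ≤ 1 →
        UbarCE ω a b ℓ d ≤ UbarCE ω a b (ℓ + 1) d') := by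
  refine ⟨fun ℓ hℓ d => csSup_le ⟨CE ω d, d, by simp [hdist], rfl⟩ ?_,
    fun ℓ hℓ d d' hd => UbarCE_le_UbarCE_succ ω a b hω hℓ d d' hd⟩
  rintro _ ⟨d', hd, rfl⟩
  exact CE_le_UbarCE ω a b hω hℓ d d' hd
end
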